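/- arXiv:0902.4608 — 2 statements merged into one kernel-verified Lean document; each statement's English description precedes it below -/
import Mathlib

section
/- For every integer m ≥ 0 there exist unique polynomials F_{m,0}(α), …, F_{m,m}(α) ∈ K[α] such that (z + qα)^m = Σ_{j=0}^{m} F_{m,j}(α) · v_j(z) · (z − q)^{m−j} holds in K[α, z], where v_j(z) = q^{−j(j−1)/2} Σ_{i=0}^{j} ([j]! [2j−i]! / ([i]! ([j−i]!)²)) (z − q)^i; moreover, for each j the polynomial F_{m,j}(α) is divisible by (1+α)^j in K[α]. -/
open Polynomial Finset

/-- Symmetric q-integer `[n] = (qⁿ − q⁻ⁿ)/(q − q⁻¹)` for `n : ℤ`. -/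
noncomputable def qint {K : Type*} [Field K] (q : K) (n : ℤ) : K :=
  (q ^ n - q ^ (-n)) / (q - q⁻¹)

/-- q-factorial `[n]! = [1][2]⋯[n]`. -/
noncomputable def qfact {K : Type*} [Field K] (q : K) : ℕ → K
  | 0 => 1
  | n + 1 => qfact q n * qint q ((n : ℤ) + 1)

/-- The polynomial `v_j(z) = q^{−j(j−1)/2} Σ_{i=0}^{j} ([j]![2j−i]!/([i]!([j−i]!)²)) (z−q)^i`. -/
noncomputable def vpoly {K : Type*} [Field K] (q : K) (j : ℕ) : Polynomial K :=
  (q ^ (j * (j - 1) / 2))⁻¹ •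
    ∑ i ∈ Finset.range (j + 1),
      Polynomial.C (qfact q j * qfact q (2 * j - i) / (qfact q i * (qfact q (j - i)) ^ 2)) *
        (Polynomial.X - Polynomial.C q) ^ i

/-- The coefficient of `(z - q)^i` in `v_j(z)`. -/
noncomputable def vcoeff {K : Type*} [Field K] (q : K) (j i : ℕ) : K :=
  (q ^ (j * (j - 1) / 2))⁻¹ *
    (qfact q j * qfact q (2 * j - i) / (qfact q i * (qfact q (j - i)) ^ 2))

theorem qint_ne_zero {K : Type*} [Field K] {q : K}
    (hq : ∀ n : ℕ, 1 ≤ n → q ^ (n : ℤ) ≠ q ^ (-(n : ℤ))) (n : ℕ) :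
    qint q ((n : ℤ) + 1) ≠ 0 := by
  have h1 := hq 1 le_rfl
  have h2 := hq (n + 1) (by omega)
  push_cast at h1 h2
  rw [zpow_neg, zpow_one] at h1
  exact div_ne_zero (sub_ne_zero.2 h2) (sub_ne_zero.2 h1)

theorem qfact_ne_zero {K : Type*} [Field K] {q : K}
    (hq : ∀ n : ℕ, 1 ≤ n → q ^ (n : ℤ) ≠ q ^ (-(n : ℤ))) (n : ℕ) : qfact q n ≠ 0 := by
  induction n with
  | zero => exact one_ne_zero
  | succ n ih => exact mul_ne_zero ih (qint_ne_zero hq n)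

theorem vcoeff_zero_ne_zero {K : Type*} [Field K] {q : K} (hq0 : q ≠ 0)
    (hq : ∀ n : ℕ, 1 ≤ n → q ^ (n : ℤ) ≠ q ^ (-(n : ℤ))) (j : ℕ) : vcoeff q j 0 ≠ 0 :=
  mul_ne_zero (inv_ne_zero (pow_ne_zero _ hq0))
    (div_ne_zero (mul_ne_zero (qfact_ne_zero hq _) (qfact_ne_zero hq _))
      (mul_ne_zero (qfact_ne_zero hq _) (pow_ne_zero _ (qfact_ne_zero hq _))))

theorem vpoly_map_C {K : Type*} [Field K] (q : K) (j : ℕ) :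
    (vpoly q j).map (C : K →+* K[X]) =
      ∑ i ∈ range (j + 1), C (C (vcoeff q j i)) * (X - C (C q)) ^ i := by
  simp only [vpoly, vcoeff, smul_eq_C_mul, Polynomial.map_mul, Polynomial.map_sum,
    Polynomial.map_pow, Polynomial.map_sub, map_C, map_X, Finset.mul_sum, C_mul, mul_assoc]

/-- The upper triangular matrix of the family `v_j(z) (z - q)^(m - j)` with respect to the
powers `(z - q)^(m - k)`. -/
noncomputable def vmatrix {K : Type*} [Field K] (q : K) (m : ℕ) :
    Matrix (Fin (m + 1)) (Fin (m + 1)) K[X] :=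
  Matrix.of fun k j => if k ≤ j then C (vcoeff q j ((j : ℕ) - k)) else 0

theorem isUnit_det_vmatrix {K : Type*} [Field K] {q : K} (hq0 : q ≠ 0)
    (hq : ∀ n : ℕ, 1 ≤ n → q ^ (n : ℤ) ≠ q ^ (-(n : ℤ))) (m : ℕ) :
    IsUnit (vmatrix q m).det := by
  have htri : (vmatrix q m).BlockTriangular id := fun k j hkj => by
    simp only [id] at hkj
    simp [vmatrix, not_le.2 hkj]
  rw [Matrix.det_of_isUpperTriangular htri]
  refine IsUnit.prod_univ_iff.2 fun k => ?_
  simpa [vmatrix] using vcoeff_zero_ne_zero hq0 hq k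

theorem sum_C_mul_X_sub_C_pow_inj {R : Type*} [CommRing R] (a : R) {m : ℕ}
    {d e : Fin (m + 1) → R}
    (h : ∑ k, C (d k) * (X - C a) ^ (m - (k : ℕ)) = ∑ k, C (e k) * (X - C a) ^ (m - (k : ℕ))) :
    d = e := by
  funext l
  have h' := congrArg (fun p : R[X] => (p.comp (X + C a)).coeff (m - l)) h
  have key : ∀ f : Fin (m + 1) → R,
      ((∑ k, C (f k) * (X - C a) ^ (m - (k : ℕ))).comp (X + C a)).coeff (m - l) = f l := by
    intro f
    simp only [Polynomial.sum_comp, mul_comp, C_comp, pow_comp, sub_comp, X_comp,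
      add_sub_cancel_right, finsetSum_coeff, coeff_C_mul, coeff_X_pow]
    rw [Finset.sum_eq_single l]
    · simp
    · intro k _ hk
      have : (k : ℕ) ≠ l := fun h => hk (Fin.ext h)
      rw [if_neg (by omega), mul_zero]
    · simp
  simpa only [key] using h'

theorem sum_vpoly_eq_sum_mulVec {K : Type*} [Field K] (q : K) (m : ℕ) (F : Fin (m + 1) → K[X]) :
    ∑ j : Fin (m + 1), C (F j) * (vpoly q (j : ℕ)).map C * (X - C (C q)) ^ (m - (j : ℕ)) =
      ∑ k : Fin (m + 1), C ((vmatrix q m).mulVec F k) * (X - C (C q)) ^ (m - (k : ℕ)) := by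
  simp only [Matrix.mulVec, dotProduct, map_sum, Finset.sum_mul]
  rw [Finset.sum_comm]
  refine Finset.sum_congr rfl fun j _ => ?_
  rw [vpoly_map_C, Finset.mul_sum, Finset.sum_mul, ← Finset.sum_range_reflect]
  refine Eq.trans ?_ (Fin.sum_univ_eq_sum_range (fun k =>
    C ((if k ≤ (j : ℕ) then C (vcoeff q j (j - k)) else 0) * F j) *
      (X - C (C q)) ^ (m - k)) (m + 1)).symm
  have hj : (j : ℕ) + 1 ≤ m + 1 := j.2
  rw [← Finset.sum_subset (Finset.range_subset_range.2 hj)]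
  · refine Finset.sum_congr rfl fun k hk => ?_
    have hk : k ≤ (j : ℕ) := Nat.lt_succ_iff.1 (Finset.mem_range.1 hk)
    rw [if_pos hk, show m - k = ((j : ℕ) + 1 - 1 - k) + (m - j) by omega, pow_add, C_mul,
      Nat.add_sub_cancel]
    ring
  · intro k _ hk
    rw [if_neg (by simpa [Nat.lt_succ_iff] using hk)]
    simp

theorem X_add_pow_eq_sum {K : Type*} [Field K] (q : K) (m : ℕ) :
    (X + C (C q * X) : K[X][X]) ^ m =
      ∑ k : Fin (m + 1), C ((m.choose k : K[X]) * (C q * (1 + X)) ^ (k : ℕ)) *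
        (X - C (C q)) ^ (m - (k : ℕ)) := by
  have h : (X + C (C q * X) : K[X][X]) = C (C q * (1 + X)) + (X - C (C q)) := by
    simp only [C_mul, C_add, map_one]
    ring
  rw [h, add_pow, Fin.sum_univ_eq_sum_range (fun k =>
    C ((m.choose k : K[X]) * (C q * (1 + X)) ^ k) * (X - C (C q) : K[X][X]) ^ (m - k))]
  refine Finset.sum_congr rfl fun k _ => ?_
  rw [map_mul C _ (_ ^ k), map_pow, map_natCast]
  ring

theorem expansion_iff_mulVec_eq {K : Type*} [Field K] (q : K) (m : ℕ) (F : Fin (m + 1) → K[X]) :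
    (X + C (C q * X) : K[X][X]) ^ m =
        ∑ j : Fin (m + 1), C (F j) * (vpoly q (j : ℕ)).map C * (X - C (C q)) ^ (m - (j : ℕ)) ↔
      (vmatrix q m).mulVec F = fun k : Fin (m + 1) => (m.choose k : K[X]) * (C q * (1 + X)) ^ (k : ℕ) := by
  rw [sum_vpoly_eq_sum_mulVec, X_add_pow_eq_sum]
  refine ⟨fun h => (sum_C_mul_X_sub_C_pow_inj _ h).symm, fun h => ?_⟩
  rw [h]

theorem existsUnique_mulVec_eq {ι R : Type*} [Fintype ι] [DecidableEq ι] [CommRing R]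
    {A : Matrix ι ι R} (hA : IsUnit A.det) (d : ι → R) : ∃! F, A.mulVec F = d := by
  have hd : A.mulVec (A⁻¹.mulVec d) = d := by
    rw [Matrix.mulVec_mulVec, Matrix.mul_nonsing_inv _ hA, Matrix.one_mulVec]
  exact ⟨A⁻¹.mulVec d, hd, fun F hF => Matrix.mulVec_injective_of_isUnit
    ((Matrix.isUnit_iff_isUnit_det _).2 hA) (hF.trans hd.symm)⟩

theorem pow_dvd_of_vmatrix_mulVec {K : Type*} [Field K] {q : K} (hq0 : q ≠ 0)
    (hq : ∀ n : ℕ, 1 ≤ n → q ^ (n : ℤ) ≠ q ^ (-(n : ℤ))) {m : ℕ} (b : K[X])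
    {F : Fin (m + 1) → K[X]} (h : ∀ k : Fin (m + 1), b ^ (k : ℕ) ∣ (vmatrix q m).mulVec F k)
    (k : Fin (m + 1)) : b ^ (k : ℕ) ∣ F k := by
  induction k using WellFoundedGT.induction with
  | ind k ih =>
    have hk := h k
    rw [Matrix.mulVec, dotProduct, ← Finset.add_sum_erase _ _ (Finset.mem_univ k)] at hk
    have hrest : b ^ (k : ℕ) ∣ ∑ j ∈ Finset.univ.erase k, vmatrix q m k j * F j := by
      refine Finset.dvd_sum fun j hj => ?_
      by_cases hkj : k ≤ j
      · have hlt : k < j := lt_of_le_of_ne hkj (Finset.ne_of_mem_erase hj).symm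
        exact ((pow_dvd_pow b (Fin.le_def.1 hkj)).trans (ih j hlt)).mul_left _
      · simp [vmatrix, hkj]
    have hdiag := (dvd_add_left hrest).1 hk
    have hu : IsUnit (vmatrix q m k k) := by
      simpa [vmatrix] using vcoeff_zero_ne_zero hq0 hq k
    exact hu.dvd_mul_left.1 hdiag

/-- There exist unique polynomials `F_{m,0}(α), …, F_{m,m}(α) ∈ K[α]` with
`(z + qα)^m = Σ_{j=0}^{m} F_{m,j}(α) v_j(z) (z − q)^{m−j}` in `K[α][z]`
(outer variable `z`, inner variable `α`); moreover each such `F_{m,j}(α)`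
is divisible by `(1+α)^j` in `K[α]`. -/
theorem stmt2 {K : Type*} [Field K] [CharZero K] (q : K) (hq0 : q ≠ 0)
    (hq : ∀ n : ℕ, 1 ≤ n → q ^ (n : ℤ) ≠ q ^ (-(n : ℤ))) (m : ℕ) :
    (∃! F : Fin (m + 1) → Polynomial K,
      (Polynomial.X + Polynomial.C (Polynomial.C q * Polynomial.X)) ^ m =
        ∑ j : Fin (m + 1),
          Polynomial.C (F j) * (vpoly q (j : ℕ)).map Polynomial.C *
            (Polynomial.X - Polynomial.C (Polynomial.C q)) ^ (m - (j : ℕ))) ∧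
    (∀ F : Fin (m + 1) → Polynomial K,
      (Polynomial.X + Polynomial.C (Polynomial.C q * Polynomial.X)) ^ m =
        ∑ j : Fin (m + 1),
          Polynomial.C (F j) * (vpoly q (j : ℕ)).map Polynomial.C *
            (Polynomial.X - Polynomial.C (Polynomial.C q)) ^ (m - (j : ℕ)) →
      ∀ j : Fin (m + 1), (1 + Polynomial.X) ^ (j : ℕ) ∣ F j) := by
  simp only [expansion_iff_mulVec_eq]
  refine ⟨?_, fun F hF => ?_⟩
  · exact existsUnique_mulVec_eq (isUnit_det_vmatrix hq0 hq m) _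
  · refine pow_dvd_of_vmatrix_mulVec hq0 hq _ fun k => ?_
    rw [hF]
    beta_reduce
    rw [mul_pow]
    exact ((dvd_refl _).mul_left _).mul_left _
end

section
/- Let m ≥ 0 be an integer, α ∈ K, and suppose c_0, …, c_m ∈ K satisfy the identity (z + qα)^m = Σ_{j=0}^{m} c_j · v_j(z) · (z − q)^{m−j} in K[z], where v_j(z) = q^{−j(j−1)/2} Σ_{i=0}^{j} ([j]! [2j−i]! / ([i]! ([j−i]!)²)) (z − q)^i. Then for every 0 ≤ l ≤ m: ([m−l]!)² · C(m,l) · q^{m−l} · (1+α)^{m−l} = Σ_{s=0}^{l} q^{−(m−s)(m−s−1)/2} · ([m−s]! [2m−l−s]! / [l−s]!) · c_{m−s}, where C(m,l) is the ordinary binomial coefficient. -/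
open Polynomial Finset

theorem qint_natCast_ne_zero {K : Type*} [Field K] {q : K}
    (hq : ∀ n : ℕ, 1 ≤ n → q ^ (n : ℤ) ≠ q ^ (-(n : ℤ))) {n : ℕ} (hn : 1 ≤ n) :
    qint q (n : ℤ) ≠ 0 := by
  refine div_ne_zero (sub_ne_zero.2 (hq n hn)) (sub_ne_zero.2 ?_)
  simpa using hq 1 le_rfl

theorem coeff_vpoly_comp {K : Type*} [Field K] (q : K) (j i : ℕ) :
    ((vpoly q j).comp (X + C q)).coeff i =
      if i ≤ j then (q ^ (j * (j - 1) / 2))⁻¹ *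
        (qfact q j * qfact q (2 * j - i) / (qfact q i * (qfact q (j - i)) ^ 2)) else 0 := by
  simp only [vpoly, smul_comp, Polynomial.sum_comp, mul_comp, C_comp, pow_comp, sub_comp, X_comp,
    add_sub_cancel_right, coeff_smul, finsetSum_coeff, coeff_C_mul_X_pow, smul_eq_mul,
    Finset.sum_ite_eq, Finset.mem_range, Nat.lt_succ_iff, mul_ite, mul_zero]

/-- If `c_0, …, c_m ∈ K` satisfy `(z + qα)^m = Σ_{j=0}^{m} c_j v_j(z) (z−q)^{m−j}` in `K[z]`,
then for every `0 ≤ l ≤ m`: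
`([m−l]!)² C(m,l) q^{m−l} (1+α)^{m−l}
  = Σ_{s=0}^{l} q^{−(m−s)(m−s−1)/2} ([m−s]![2m−l−s]!/[l−s]!) c_{m−s}`. -/
theorem stmt3 {K : Type*} [Field K] [CharZero K] (q : K) (hq0 : q ≠ 0)
    (hq : ∀ n : ℕ, 1 ≤ n → q ^ (n : ℤ) ≠ q ^ (-(n : ℤ)))
    (m : ℕ) (α : K) (c : ℕ → K)
    (hc : (Polynomial.X + Polynomial.C (q * α)) ^ m =
      ∑ j ∈ Finset.range (m + 1),
        Polynomial.C (c j) * vpoly q j * (Polynomial.X - Polynomial.C q) ^ (m - j)) :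
    ∀ l ≤ m,
      (qfact q (m - l)) ^ 2 * (Nat.choose m l : K) * q ^ (m - l) * (1 + α) ^ (m - l) =
        ∑ s ∈ Finset.range (l + 1),
          (q ^ ((m - s) * (m - s - 1) / 2))⁻¹ *
            (qfact q (m - s) * qfact q (2 * m - l - s) / qfact q (l - s)) * c (m - s) := by
  intro l hl
  have hcoeff := congrArg (fun p : K[X] => (p.comp (X + C q)).coeff l) hc
  have hX : (X + C q + C (q * α) : K[X]) = X + C (q * (1 + α)) := by
    rw [add_assoc, ← C_add, mul_add, mul_one]
  simp only [pow_comp, add_comp, X_comp, C_comp, hX, coeff_X_add_C_pow, Polynomial.sum_comp,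
    mul_comp, sub_comp, add_sub_cancel_right, finsetSum_coeff, coeff_mul_X_pow', coeff_C_mul,
    coeff_vpoly_comp] at hcoeff
  rw [← Finset.sum_range_reflect] at hcoeff
  have hf := qfact_ne_zero hq
  calc
    _ = qfact q (m - l) ^ 2 * ((q * (1 + α)) ^ (m - l) * (m.choose l : K)) := by
      rw [mul_pow]; ring
    _ = _ := by
      rw [hcoeff, Finset.mul_sum]
      symm
      refine Finset.sum_subset_zero_on_sdiff (Finset.range_mono (by omega)) ?_ ?_
      · intro s hs
        simp only [Finset.mem_sdiff, Finset.mem_range] at hs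
        rw [if_neg (by omega), mul_zero]
      · intro s hs
        rw [Finset.mem_range] at hs
        rw [show m + 1 - 1 - s = m - s by omega, show m - (m - s) = s by omega,
          if_pos (by omega), if_pos (by omega), show m - s - (l - s) = m - l by omega,
          show 2 * (m - s) - (l - s) = 2 * m - l - s by omega]
        have h₁ := hf (m - l)
        have h₂ := hf (l - s)
        field_simp
end
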